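/- For all k₁, k₂, k₃ ∈ ℤ and all signs μ, ν ∈ {+,−}, the multiplier norm of the reciprocal phase satisfies ‖Φ_{μν}^{−1}‖_{S^∞_{k₁,k₂;k₃}} ≲ 2^{7·min(k₁,k₂,k₃)⁺}, i.e. ‖φ_{k₃}(ξ₁+ξ₂)·Φ_{μν}(ξ₁,ξ₂)^{−1}·φ_{k₁}(ξ₁)·φ_{k₂}(ξ₂)‖_{S^∞} ≲ 2^{7·min(k₁,k₂,k₃)⁺}, with an implicit constant independent of k₁, k₂, k₃. -/

import Mathlib

/-!
Common framework: functions on the torus `𝕋_R = (ℝ/Rℤ)²` are modelled as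
`R`-periodic functions on `ℝ²`; Fourier multipliers are defined through the
Fourier coefficients on the frequency lattice `(2πℤ/R)²`.
-/

noncomputable section

open MeasureTheory Real Set
open scoped ENNReal NNReal

abbrev T2 : Type := ℝ × ℝ

namespace EP

/-- Euclidean dot product on ℝ². -/
def dot2 (x y : T2) : ℝ := x.1 * y.1 + x.2 * y.2

/-- Euclidean norm on ℝ². -/
def en (x : T2) : ℝ := Real.sqrt (dot2 x x)

/-- A point of the lattice (Rℤ)². -/
def lat (R : ℝ) (k : ℤ × ℤ) : T2 := (R * (k.1 : ℝ), R * (k.2 : ℝ))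

/-- A point of the frequency lattice (2πℤ/R)². -/
def freq (R : ℝ) (k : ℤ × ℤ) : T2 := (2 * π * (k.1 : ℝ) / R, 2 * π * (k.2 : ℝ) / R)

/-- R-periodicity (function on the torus of size R). -/
def PeriodicC (R : ℝ) (u : T2 → ℂ) : Prop := ∀ (x : T2) (k : ℤ × ℤ), u (x + lat R k) = u x

def PeriodicR (R : ℝ) (u : T2 → ℝ) : Prop := ∀ (x : T2) (k : ℤ × ℤ), u (x + lat R k) = u x

/-- A fundamental domain for the torus. -/
def box (R : ℝ) : Set T2 := Ioc (0:ℝ) R ×ˢ Ioc (0:ℝ) R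

/-- Lebesgue measure on the fundamental domain. -/
def μbox (R : ℝ) : Measure T2 := volume.restrict (box R)

/-- Fourier coefficient û(ξ) at ξ = freq R k. -/
def fCoeff (R : ℝ) (u : T2 → ℂ) (k : ℤ × ℤ) : ℂ :=
  ∫ x in box R, u x * Complex.exp (-Complex.I * ((dot2 x (freq R k) : ℝ) : ℂ))

/-- Fourier multiplier with symbol m. -/
def op (R : ℝ) (m : T2 → ℂ) (u : T2 → ℂ) : T2 → ℂ := fun x =>
  (1 / (R : ℂ) ^ 2) * ∑' k : ℤ × ℤ,
    m (freq R k) * fCoeff R u k * Complex.exp (Complex.I * ((dot2 x (freq R k) : ℝ) : ℂ))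

/-- L^p norm on the torus (valued in ℝ≥0∞). -/
def LpE (R : ℝ) (p : ℝ≥0∞) (u : T2 → ℂ) : ℝ≥0∞ := eLpNorm u p (μbox R)

/-- Λ(ξ) = √(1+|ξ|²). -/
def lam (ξ : T2) : ℝ := Real.sqrt (1 + dot2 ξ ξ)

/-- The operator Λ^s. -/
def lamPow (R : ℝ) (s : ℝ) (u : T2 → ℂ) : T2 → ℂ :=
  op R (fun ξ => ((lam ξ ^ s : ℝ) : ℂ)) u

/-- H^s norm: ‖Λ^s u‖_{L²}. -/
def HNe (R : ℝ) (s : ℝ) (u : T2 → ℂ) : ℝ≥0∞ := LpE R 2 (lamPow R s u)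

/-- Complexification of a real function. -/
def cf (u : T2 → ℝ) : T2 → ℂ := fun x => (u x : ℂ)

/-- |∇|^{-1} (acting as 0 on the zero frequency). -/
def invGrad (R : ℝ) (u : T2 → ℂ) : T2 → ℂ := op R (fun ξ => (((en ξ)⁻¹ : ℝ) : ℂ)) u

/-- |∇|. -/
def absGrad (R : ℝ) (u : T2 → ℂ) : T2 → ℂ := op R (fun ξ => ((en ξ : ℝ) : ℂ)) u

/-- Λ|∇|^{-1}. -/
def LamInvGrad (R : ℝ) (u : T2 → ℂ) : T2 → ℂ :=
  op R (fun ξ => ((lam ξ * (en ξ)⁻¹ : ℝ) : ℂ)) u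

/-- The linear propagator e^{itΛ}. -/
def flow (R : ℝ) (t : ℝ) (u : T2 → ℂ) : T2 → ℂ :=
  op R (fun ξ => Complex.exp (Complex.I * (t : ℂ) * ((lam ξ : ℝ) : ℂ))) u

/-- U = Λ|∇|^{-1}ρ + i|∇|h. -/
def Ufun (R : ℝ) (ρ h : T2 → ℝ) : T2 → ℂ := fun x =>
  LamInvGrad R (cf ρ) x + Complex.I * absGrad R (cf h) x

/-- Partial derivatives on ℝ². -/
def d1 (f : T2 → ℝ) (x : T2) : ℝ := fderiv ℝ f x ((1:ℝ), (0:ℝ))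
def d2 (f : T2 → ℝ) (x : T2) : ℝ := fderiv ℝ f x ((0:ℝ), (1:ℝ))
def grad2 (f : T2 → ℝ) (x : T2) : T2 := (d1 f x, d2 f x)
def div2 (v : T2 → T2) (x : T2) : ℝ := d1 (fun y => (v y).1) x + d2 (fun y => (v y).2) x
def lap2 (f : T2 → ℝ) (x : T2) : ℝ := d1 (d1 f) x + d2 (d2 f) x

/-- The Euler–Poisson system on the torus of size `R`, on the time interval `[0, T]`,
for an irrotational velocity `v = ∇h`: `ρ_t + ∇·((1+ρ)v) = 0`,
`v_t + (v·∇)v + ∇ρ = ∇φ`, `Δφ = ρ`, with charge neutrality and zero momentum. -/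
structure IsEPSol (R T : ℝ) (ρ h φp : ℝ → T2 → ℝ) : Prop where
  per_rho : ∀ t ∈ Icc (0:ℝ) T, PeriodicR R (ρ t)
  per_h : ∀ t ∈ Icc (0:ℝ) T, PeriodicR R (h t)
  per_phi : ∀ t ∈ Icc (0:ℝ) T, PeriodicR R (φp t)
  reg_rho : ∀ t ∈ Icc (0:ℝ) T, ContDiff ℝ 1 (ρ t)
  reg_h : ∀ t ∈ Icc (0:ℝ) T, ContDiff ℝ 2 (h t)
  reg_phi : ∀ t ∈ Icc (0:ℝ) T, ContDiff ℝ 2 (φp t)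
  reg_t_rho : ∀ t ∈ Icc (0:ℝ) T, ∀ x : T2, DifferentiableAt ℝ (fun s => ρ s x) t
  reg_t_v : ∀ t ∈ Icc (0:ℝ) T, ∀ x : T2,
    DifferentiableAt ℝ (fun s => (grad2 (h s) x).1) t ∧
    DifferentiableAt ℝ (fun s => (grad2 (h s) x).2) t
  cont_eq : ∀ t ∈ Icc (0:ℝ) T, ∀ x : T2,
    deriv (fun s => ρ s x) t + div2 (fun y => (1 + ρ t y) • grad2 (h t) y) x = 0
  mom_eq1 : ∀ t ∈ Icc (0:ℝ) T, ∀ x : T2,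
    deriv (fun s => (grad2 (h s) x).1) t
      + (grad2 (h t) x).1 * d1 (fun y => (grad2 (h t) y).1) x
      + (grad2 (h t) x).2 * d2 (fun y => (grad2 (h t) y).1) x
      + d1 (ρ t) x = d1 (φp t) x
  mom_eq2 : ∀ t ∈ Icc (0:ℝ) T, ∀ x : T2,
    deriv (fun s => (grad2 (h s) x).2) t
      + (grad2 (h t) x).1 * d1 (fun y => (grad2 (h t) y).2) x
      + (grad2 (h t) x).2 * d2 (fun y => (grad2 (h t) y).2) x
      + d2 (ρ t) x = d2 (φp t) x
  poisson_eq : ∀ t ∈ Icc (0:ℝ) T, ∀ x : T2, lap2 (φp t) x = ρ t x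
  neutral : ∀ t ∈ Icc (0:ℝ) T, (∫ x in box R, ρ t x) = 0
  zero_mom : ∀ t ∈ Icc (0:ℝ) T, (∫ x in box R, grad2 (h t) x) = (0 : T2)

/-- `U ∈ C([0,T], H^s)`: finiteness of the `H^s` norm and continuity in the `H^s` metric. -/
def ContHN (R : ℝ) (s T : ℝ) (U : ℝ → T2 → ℂ) : Prop :=
  (∀ t ∈ Icc (0:ℝ) T, HNe R s (U t) < ⊤) ∧
  (∀ t ∈ Icc (0:ℝ) T, ∀ ε : ℝ, 0 < ε → ∃ δ : ℝ, 0 < δ ∧ ∀ t' ∈ Icc (0:ℝ) T,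
    |t' - t| < δ → HNe R s (fun x => U t' x - U t x) < ENNReal.ofReal ε)

/-- `U ∈ C¹([0,T], H^s)`: differentiability in the `H^s` metric with continuous derivative. -/
def C1HN (R : ℝ) (s T : ℝ) (U : ℝ → T2 → ℂ) : Prop :=
  ∃ U' : ℝ → T2 → ℂ, ContHN R s T U' ∧
    ∀ t ∈ Icc (0:ℝ) T, ∀ ε : ℝ, 0 < ε → ∃ δ : ℝ, 0 < δ ∧ ∀ t' ∈ Icc (0:ℝ) T,
      t' ≠ t → |t' - t| < δ →
      HNe R s (fun x => (((t' - t : ℝ) : ℂ))⁻¹ * (U t' x - U t x) - U' t x)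
        < ENNReal.ofReal ε

/-- H^s norm of a vector field (sum over the two components). -/
def HNev (R : ℝ) (s : ℝ) (v : T2 → T2) : ℝ≥0∞ :=
  HNe R s (cf (fun x => (v x).1)) + HNe R s (cf (fun x => (v x).2))

/-- A smooth radial-type cutoff: 1 on B(0,2/3), 0 outside B(0,3/2), values in [0,1]. -/
def IsCutoff (φ : T2 → ℝ) : Prop :=
  ContDiff ℝ (⊤ : ℕ∞) φ ∧ (∀ x : T2, φ x ∈ Icc (0:ℝ) 1) ∧
  (∀ x : T2, en x ≤ 2/3 → φ x = 1) ∧ (∀ x : T2, (3:ℝ)/2 ≤ en x → φ x = 0)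

/-- φ_k(ξ) = φ(ξ/2^k) − φ(ξ/2^{k-1}). -/
def phiK (φ : T2 → ℝ) (k : ℤ) (ξ : T2) : ℝ :=
  φ ((2:ℝ) ^ (-k) • ξ) - φ ((2:ℝ) ^ (-(k-1)) • ξ)

/-- Littlewood–Paley projection P_k. -/
def PK (R : ℝ) (φ : T2 → ℝ) (k : ℤ) (u : T2 → ℂ) : T2 → ℂ :=
  op R (fun ξ => ((phiK φ k ξ : ℝ) : ℂ)) u

/-- P_{[a,b]} = Σ_{a ≤ k ≤ b} P_k. -/
def PKband (R : ℝ) (φ : T2 → ℝ) (a b : ℤ) (u : T2 → ℂ) : T2 → ℂ := fun x =>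
  ∑ j ∈ Finset.Icc a b, PK R φ j u x

/-- P_{≥0} = Σ_{k ≥ 0} P_k, i.e. the multiplier 1 − φ_{≤ -1}(ξ) = 1 − φ(2ξ). -/
def Pge0 (R : ℝ) (φ : T2 → ℝ) (u : T2 → ℂ) : T2 → ℂ :=
  op R (fun ξ => (((1 : ℝ) - φ ((2:ℝ) • ξ) : ℝ) : ℂ)) u

/-- k⁺ = max(k, 0). -/
def kplus (k : ℤ) : ℤ := max k 0

/-- The X norm: Σ_k 2^{Mk⁺} ‖P_k u‖_{L^∞}. -/
def XnormE (R : ℝ) (φ : T2 → ℝ) (M : ℕ) (u : T2 → ℂ) : ℝ≥0∞ :=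
  ∑' k : ℤ, ENNReal.ofReal ((2:ℝ) ^ ((M : ℤ) * kplus k)) * LpE R ⊤ (PK R φ k u)

/-- ‖x‖ = dist(x, (Rℤ)²). -/
def torusDist (R : ℝ) (x : T2) : ℝ := ⨅ k : ℤ × ℤ, en (x - lat R k)

/-- The Z norm: ‖(1+‖x‖)^{2/3} Λ^{M+2} u‖_{L²}. -/
def ZnormE (R : ℝ) (M : ℕ) (u : T2 → ℂ) : ℝ≥0∞ :=
  LpE R 2 (fun x => (((1 + torusDist R x) ^ ((2:ℝ)/3) : ℝ) : ℂ) * lamPow R ((M:ℝ) + 2) u x)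

def ZnormEv (R : ℝ) (M : ℕ) (v : T2 → T2) : ℝ≥0∞ :=
  ZnormE R M (cf (fun x => (v x).1)) + ZnormE R M (cf (fun x => (v x).2))

/-- ‖U‖_{L²([0,t]) X}. -/
def L2X (R : ℝ) (φ : T2 → ℝ) (M : ℕ) (t : ℝ) (U : ℝ → T2 → ℂ) : ℝ≥0∞ :=
  (∫⁻ s in Icc (0:ℝ) t, (XnormE R φ M (U s)) ^ 2) ^ ((1:ℝ)/2)

/-- Fourier coefficient in x of a symbol a(x,ζ). -/
def symCoeff (R : ℝ) (a : T2 → T2 → ℂ) (k : ℤ × ℤ) (ζ : T2) : ℂ :=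
  ∫ x in box R, a x ζ * Complex.exp (-Complex.I * ((dot2 x (freq R k) : ℝ) : ℂ))

/-- φ_{≤-10}(|ξ−η|/|ξ+η|), taken to be 0 when ξ+η = 0. -/
def cutRatio (φ : T2 → ℝ) (ξ η : T2) : ℝ :=
  if ξ + η = (0 : T2) then 0
  else φ ((((2:ℝ) ^ (10 : ℕ) * en (ξ - η) / en (ξ + η) : ℝ), (0:ℝ)) : T2)

/-- The (Weyl-quantized) paradifferential operator T_a. -/
def Ta (R : ℝ) (φ : T2 → ℝ) (a : T2 → T2 → ℂ) (f : T2 → ℂ) : T2 → ℂ := fun x =>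
  (1 / (R : ℂ) ^ 2) * ∑' ξi : ℤ × ℤ,
    ((1 / (R : ℂ) ^ 2) * ∑' ηi : ℤ × ℤ,
      ((cutRatio φ (freq R ξi) (freq R ηi) : ℝ) : ℂ) *
        symCoeff R a (ξi - ηi) ((2:ℝ)⁻¹ • (freq R ξi + freq R ηi)) * fCoeff R f ηi) *
    Complex.exp (Complex.I * ((dot2 x (freq R ξi) : ℝ) : ℂ))

/-- |a|(x,ζ) = Σ_{|I| ≤ 8} |ζ|^{|I|} |∂^I_ζ a(x,ζ)|. -/
def symAbs (a : T2 → T2 → ℂ) (x ζ : T2) : ℝ :=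
  ∑ n ∈ Finset.range 9, en ζ ^ n * ‖iteratedFDeriv ℝ n (a x) ζ‖

/-- ‖a‖_{𝓛^q_m} ≤ A, stated as: ‖ |a|(·,ζ) ‖_{L^q} ≤ A (1+|ζ|)^m for all ζ ≠ 0. -/
def SymLe (R : ℝ) (m : ℝ) (q : ℝ≥0∞) (a : T2 → T2 → ℂ) (A : ℝ) : Prop :=
  ∀ ζ : T2, ζ ≠ 0 →
    eLpNorm (fun x => symAbs a x ζ) q (μbox R) ≤ ENNReal.ofReal (A * (1 + en ζ) ^ m)

def symAbsDx (a : T2 → T2 → ℂ) (x ζ : T2) : ℝ :=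
  ∑ n ∈ Finset.range 9,
    en ζ ^ n * ‖iteratedFDeriv ℝ n (fun ζ' => fderiv ℝ (fun x' => a x' ζ') x) ζ‖

/-- ‖∇_x a‖_{𝓛^q_m} ≤ A. -/
def SymDxLe (R : ℝ) (m : ℝ) (q : ℝ≥0∞) (a : T2 → T2 → ℂ) (A : ℝ) : Prop :=
  ∀ ζ : T2, ζ ≠ 0 →
    eLpNorm (fun x => symAbsDx a x ζ) q (μbox R) ≤ ENNReal.ofReal (A * (1 + en ζ) ^ m)

/-- T_f for a symbol f(x) independent of ζ. -/
def TaF (R : ℝ) (φ : T2 → ℝ) (f g : T2 → ℂ) : T2 → ℂ := Ta R φ (fun x _ => f x) g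

/-- H(f,g) = fg − T_f g − T_g f. -/
def Hbil (R : ℝ) (φ : T2 → ℝ) (f g : T2 → ℂ) : T2 → ℂ := fun x =>
  f x * g x - TaF R φ f g x - TaF R φ g f x

/-- E(a,b) = T_a T_b − T_{ab}. -/
def E2 (R : ℝ) (φ : T2 → ℝ) (a b : T2 → T2 → ℂ) (f : T2 → ℂ) : T2 → ℂ := fun x =>
  Ta R φ a (Ta R φ b f) x - Ta R φ (fun y ζ => a y ζ * b y ζ) f x

/-- E(a,b,c) = T_a T_b T_c − T_{abc}. -/
def E3 (R : ℝ) (φ : T2 → ℝ) (a b c : T2 → T2 → ℂ) (f : T2 → ℂ) : T2 → ℂ := fun x =>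
  Ta R φ a (Ta R φ b (Ta R φ c f)) x - Ta R φ (fun y ζ => a y ζ * b y ζ * c y ζ) f x

/-- T_{a_1} ⋯ T_{a_n}. -/
def TaChain (R : ℝ) (φ : T2 → ℝ) : {n : ℕ} → (Fin n → T2 → T2 → ℂ) → (T2 → ℂ) → (T2 → ℂ)
  | 0, _, f => f
  | _ + 1, a, f => Ta R φ (a 0) (TaChain R φ (fun j => a j.succ) f)

/-- E(a_1,…,a_n) = T_{a_1}⋯T_{a_n} − T_{a_1⋯a_n}. -/
def EnOp (R : ℝ) (φ : T2 → ℝ) {n : ℕ} (a : Fin n → T2 → T2 → ℂ) (f : T2 → ℂ) : T2 → ℂ :=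
  fun x => TaChain R φ a f x - Ta R φ (fun y ζ => ∏ j, a j y ζ) f x

/-- Real part of the L² inner product on the torus. -/
def ipRe (R : ℝ) (f g : T2 → ℂ) : ℝ := (∫ x in box R, f x * (starRingEnd ℂ) (g x)).re

/-- The phase Φ_{μν}(ξ₁,ξ₂) = Λ(ξ₁+ξ₂) − μΛ(ξ₁) − νΛ(ξ₂), for signs μ, ν ∈ {1,-1}. -/
def Phi (μ ν : ℝ) (ξ₁ ξ₂ : T2) : ℝ := lam (ξ₁ + ξ₂) - μ * lam ξ₁ - ν * lam ξ₂

def mA (ξ₁ ξ₂ : T2) : ℂ := ((lam (ξ₁ + ξ₂) * en ξ₁ / lam ξ₁ : ℝ) : ℂ)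
def mB (ξ₁ ξ₂ : T2) : ℂ := ((lam (ξ₁ + ξ₂) * en ξ₂ / lam ξ₂ : ℝ) : ℂ)
def mC (ξ₁ ξ₂ : T2) : ℂ := ((en (ξ₁ + ξ₂) : ℝ) : ℂ)

/-- The basic quadratic multipliers of the Euler–Poisson nonlinearity. -/
def IsBasicM (m : T2 → T2 → ℂ) : Prop := m = mA ∨ m = mB ∨ m = mC

/-- f_+ = f, f_- = conj f (for a sign μ ∈ {1,-1}). -/
def sgnFun (μ : ℝ) (f : T2 → ℂ) : T2 → ℂ :=
  if μ = 1 then f else fun x => (starRingEnd ℂ) (f x)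

/-- v_j, the j-th component of v = ∇h. -/
def vcomp (h : T2 → ℝ) (j : Fin 2) : T2 → ℝ := fun x => if j = 0 then d1 h x else d2 h x

/-- The semilinear quadratic term 𝓢 = −ΛR_j H(ρ, v_j) − (i/2)|∇|H(v_j, v_j). -/
def calS (R : ℝ) (φ : T2 → ℝ) (ρ h : T2 → ℝ) : T2 → ℂ := fun x =>
  -(∑ j : Fin 2, op R
      (fun ξ => ((lam ξ : ℝ) : ℂ) *
        (Complex.I * (((if j = (0 : Fin 2) then ξ.1 else ξ.2) : ℝ) : ℂ) * (((en ξ)⁻¹ : ℝ) : ℂ)))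
      (Hbil R φ (cf ρ) (cf (vcomp h j))) x)
  - (Complex.I / 2) * ∑ j : Fin 2, absGrad R (Hbil R φ (cf (vcomp h j)) (cf (vcomp h j))) x

/-- 𝓤 = X + i T_{√(1+ρ)} Y. -/
def calU (R : ℝ) (φ : T2 → ℝ) (ρ h : T2 → ℝ) : T2 → ℂ := fun x =>
  LamInvGrad R (cf ρ) x +
    Complex.I * Ta R φ (fun y _ => ((Real.sqrt (1 + ρ y) : ℝ) : ℂ)) (absGrad R (cf h)) x

def sqrtSym (ρ : T2 → ℝ) : T2 → T2 → ℂ := fun y _ => ((Real.sqrt (1 + ρ y) : ℝ) : ℂ)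
def sqrtm1Sym (ρ : T2 → ℝ) : T2 → T2 → ℂ := fun y _ => ((Real.sqrt (1 + ρ y) - 1 : ℝ) : ℂ)
def vdotSym (h : T2 → ℝ) : T2 → T2 → ℂ := fun y ζ => ((dot2 (grad2 h y) ζ : ℝ) : ℂ)
def lamSym2 : T2 → T2 → ℂ := fun _ ζ => ((lam ζ : ℝ) : ℂ)
def enSym2 : T2 → T2 → ℂ := fun _ ζ => ((en ζ : ℝ) : ℂ)
def zetaOverEn (j : Fin 2) : T2 → T2 → ℂ :=
  fun _ ζ => (((if j = (0 : Fin 2) then ζ.1 else ζ.2) * (en ζ)⁻¹ : ℝ) : ℂ)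
def lamZetaOverEn (j : Fin 2) : T2 → T2 → ℂ :=
  fun _ ζ => ((lam ζ * (if j = (0 : Fin 2) then ζ.1 else ζ.2) * (en ζ)⁻¹ : ℝ) : ℂ)
def enOverLam : T2 → T2 → ℂ := fun _ ζ => ((en ζ * (lam ζ)⁻¹ : ℝ) : ℂ)
def rhoSym (ρ : T2 → ℝ) : T2 → T2 → ℂ := fun y _ => ((ρ y : ℝ) : ℂ)
def vjSym (h : T2 → ℝ) (j : Fin 2) : T2 → T2 → ℂ := fun y _ => ((vcomp h j y : ℝ) : ℂ)
/-- Fourier transform on `(ℝ²)² = ℝ⁴` (up to normalization). -/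
def ft2 (m : T2 → T2 → ℂ) (y : T2 × T2) : ℂ :=
  ∫ x : T2 × T2, m x.1 x.2 *
    Complex.exp (-Complex.I * ((dot2 x.1 y.1 + dot2 x.2 y.2 : ℝ) : ℂ))

/-- `‖m‖_{S^∞} = ‖𝓕m‖_{L¹(ℝ⁴)}`. -/
def Soo2 (m : T2 → T2 → ℂ) : ℝ≥0∞ := ∫⁻ y : T2 × T2, ‖ft2 m y‖₊

lemma exists_bound_iteratedFDeriv_inv_one_add_sq (n : ℕ) :
    ∃ C : ℝ, ∀ u : ℝ, ‖iteratedFDeriv ℝ n (fun u : ℝ => (1 + u ^ 2)⁻¹) u‖ ≤ C := by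
  set h : ℝ → ℝ := fun u => (1 + u ^ 2)⁻¹ with hh
  set g : ℝ → ℝ := fun u => u * (1 + u ^ 2)⁻¹ with hg
  have hmem : h ∈ Algebra.adjoin ℝ {h, g} := Algebra.subset_adjoin (by simp)
  have gmem : g ∈ Algebra.adjoin ℝ {h, g} := Algebra.subset_adjoin (by simp)
  have hne (u : ℝ) : 1 + u ^ 2 ≠ 0 := by positivity
  have hder (u : ℝ) : HasDerivAt h (-2 * h u * g u) u := by
    have := (((hasDerivAt_id' u).pow 2).const_add 1).inv (hne u)
    refine this.congr_deriv ?_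
    simp only [hh, hg]
    have := hne u
    push_cast
    simp only [Pi.pow_apply]
    field_simp
  have gder (u : ℝ) : HasDerivAt g (2 * h u * h u - h u) u := by
    refine ((hasDerivAt_id' u).mul (hder u)).congr_deriv ?_
    simp only [hh, hg]
    have := hne u
    field_simp
    ring
  have key : ∀ f ∈ Algebra.adjoin ℝ {h, g},
      Differentiable ℝ f ∧ deriv f ∈ Algebra.adjoin ℝ {h, g} ∧ ∃ C : ℝ, ∀ u, |f u| ≤ C := by
    intro f hf
    induction hf using Algebra.adjoin_induction with
    | mem f hf =>
      rcases hf with rfl | rfl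
      · refine ⟨fun u => (hder u).differentiableAt, ?_, 1, fun u => ?_⟩
        · have : deriv h = algebraMap ℝ (ℝ → ℝ) (-2) * h * g := funext fun u => (hder u).deriv
          rw [this]
          exact mul_mem (mul_mem (Subalgebra.algebraMap_mem _ _) hmem) gmem
        · have : 0 ≤ (1 + u ^ 2)⁻¹ := by positivity
          simp only [hh, abs_of_nonneg this]
          exact inv_le_one_of_one_le₀ (by nlinarith [sq_nonneg u])
      · refine ⟨fun u => (gder u).differentiableAt, ?_, 1, fun u => ?_⟩
        · have : deriv g = algebraMap ℝ (ℝ → ℝ) 2 * h * h - h := funext fun u => (gder u).deriv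
          rw [this]
          exact sub_mem (mul_mem (mul_mem (Subalgebra.algebraMap_mem _ _) hmem) hmem) hmem
        · have hpos : (0 : ℝ) < 1 + u ^ 2 := by positivity
          simp only [hg, ← div_eq_mul_inv, abs_div, abs_of_pos hpos]
          rw [div_le_one hpos]
          nlinarith [sq_abs u, sq_nonneg (|u| - 1)]
    | algebraMap r =>
      refine ⟨differentiable_const r, ?_, |r|, fun u => le_rfl⟩
      have : deriv (algebraMap ℝ (ℝ → ℝ) r) = algebraMap ℝ (ℝ → ℝ) 0 :=
        funext fun u => deriv_const u r
      rw [this]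
      exact Subalgebra.algebraMap_mem _ _
    | add x y _ _ hx hy =>
      obtain ⟨hx1, hx2, Cx, hx3⟩ := hx
      obtain ⟨hy1, hy2, Cy, hy3⟩ := hy
      refine ⟨hx1.add hy1, ?_, Cx + Cy, fun u => (abs_add_le _ _).trans (add_le_add (hx3 u) (hy3 u))⟩
      have : deriv (x + y) = deriv x + deriv y := funext fun u => deriv_add (hx1 u) (hy1 u)
      rw [this]
      exact add_mem hx2 hy2
    | mul x y hxm hym hx hy =>
      obtain ⟨hx1, hx2, Cx, hx3⟩ := hx
      obtain ⟨hy1, hy2, Cy, hy3⟩ := hy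
      refine ⟨hx1.mul hy1, ?_, Cx * Cy, fun u => ?_⟩
      · have : deriv (x * y) = deriv x * y + x * deriv y :=
          funext fun u => deriv_mul (hx1 u) (hy1 u)
        rw [this]
        exact add_mem (mul_mem hx2 hym) (mul_mem hxm hy2)
      · rw [Pi.mul_apply, abs_mul]
        exact mul_le_mul (hx3 u) (hy3 u) (abs_nonneg _) ((abs_nonneg _).trans (hx3 u))
  have bdd : ∀ n, ∀ f ∈ Algebra.adjoin ℝ {h, g}, ∃ C : ℝ, ∀ u, |iteratedDeriv n f u| ≤ C := by
    intro n
    induction n with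
    | zero => intro f hf; simpa using (key f hf).2.2
    | succ n ih => intro f hf; rw [iteratedDeriv_succ']; exact ih _ (key f hf).2.1
  obtain ⟨C, hC⟩ := bdd n h hmem
  exact ⟨C, fun u => by simpa [norm_iteratedFDeriv_eq_norm_iteratedDeriv] using hC u⟩

section Parametric

variable {P V : Type*} [NormedAddCommGroup P] [NormedSpace ℝ P] [NormedAddCommGroup V]
  [NormedSpace ℝ V]

lemma norm_iteratedFDeriv_partial_le {F : P × V → ℝ} (hF : ContDiff ℝ (⊤ : ℕ∞) F) (n : ℕ)
    (p : P) (z : V) :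
    ‖iteratedFDeriv ℝ n (fun z => F (p, z)) z‖ ≤ ‖iteratedFDeriv ℝ n F (p, z)‖ := by
  have h1 : (fun z => F (p, z)) =
      (fun w => F ((p, 0) + w)) ∘ (ContinuousLinearMap.inr ℝ P V) := by
    ext z; simp
  have h2 : ContDiff ℝ (⊤ : ℕ∞) (fun w => F ((p, 0) + w)) := hF.comp (by fun_prop)
  rw [h1, ContinuousLinearMap.iteratedFDeriv_comp_right _ h2 _ (by exact_mod_cast le_top),
    iteratedFDeriv_comp_add_left]
  refine (ContinuousMultilinearMap.norm_compContinuousLinearMap_le _ _).trans ?_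
  have h3 : ∏ _i : Fin n, ‖ContinuousLinearMap.inr ℝ P V‖ ≤ 1 :=
    Finset.prod_le_one (fun _ _ => norm_nonneg _)
      fun _ _ => ContinuousLinearMap.norm_inr_le_one ℝ P V
  simpa using mul_le_of_le_one_right (norm_nonneg _) h3

lemma exists_bound_iteratedFDeriv_partial {F : P × V → ℝ} (hF : ContDiff ℝ (⊤ : ℕ∞) F)
    {K : Set (P × V)} (hK : IsCompact K) (N : ℕ) :
    ∃ C : ℝ, 1 ≤ C ∧ ∀ n ≤ N, ∀ p z, (p, z) ∈ K →
      ‖iteratedFDeriv ℝ n (fun z => F (p, z)) z‖ ≤ C := by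
  have h (n : ℕ) : ∃ C : ℝ, ∀ w ∈ K, ‖iteratedFDeriv ℝ n F w‖ ≤ C := by
    obtain ⟨C, hC⟩ := hK.exists_bound_of_continuousOn
      (hF.continuous_iteratedFDeriv (m := n) (by exact_mod_cast le_top)).continuousOn
    exact ⟨C, hC⟩
  choose C hC using h
  refine ⟨1 + ∑ n ∈ Finset.range (N + 1), |C n|, ?_, fun n hn p z hz => ?_⟩
  · linarith [Finset.sum_nonneg fun n (_ : n ∈ Finset.range (N + 1)) => abs_nonneg (C n)]
  · have h1 := Finset.single_le_sum (f := fun n => |C n|) (fun n _ => abs_nonneg (C n))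
      (Finset.mem_range.2 (Nat.lt_succ_of_le hn))
    linarith [norm_iteratedFDeriv_partial_le hF n p z, hC n _ hz, le_abs_self (C n)]

lemma exists_bound_iteratedFDeriv_mul_inv_one_add_sq [ProperSpace V] {H W : P × V → ℝ}
    (hH : ContDiff ℝ (⊤ : ℕ∞) H) (hW : ContDiff ℝ (⊤ : ℕ∞) W) {K : Set P} (hK : IsCompact K)
    (r : ℝ) (hr : ∀ p z, r < ‖z‖ → H (p, z) = 0) (N : ℕ) :
    ∃ C : ℝ, 0 ≤ C ∧ ∀ p ∈ K, ∀ R : ℝ, 1 ≤ R → ∀ n ≤ N, ∀ z,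
      ‖iteratedFDeriv ℝ n (fun z => R * H (p, z) * (1 + (R * W (p, z)) ^ 2)⁻¹) z‖
        ≤ C * R ^ (N + 1) := by
  have hcpt : IsCompact (K ×ˢ Metric.closedBall (0 : V) r) :=
    hK.prod (isCompact_closedBall 0 r)
  obtain ⟨CH, hCH1, hCH⟩ := exists_bound_iteratedFDeriv_partial hH hcpt N
  obtain ⟨CW, hCW1, hCW⟩ := exists_bound_iteratedFDeriv_partial hW hcpt N
  choose c hc using exists_bound_iteratedFDeriv_inv_one_add_sq
  set D : ℝ := ∑ n ∈ Finset.range (N + 1), |c n| with hD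
  have hD0 : 0 ≤ D := Finset.sum_nonneg fun n _ => abs_nonneg _
  have hDc (n : ℕ) (hn : n ≤ N) (u : ℝ) :
      ‖iteratedFDeriv ℝ n (fun u : ℝ => (1 + u ^ 2)⁻¹) u‖ ≤ D :=
    (hc n u).trans <| (le_abs_self _).trans <|
      Finset.single_le_sum (f := fun n => |c n|) (fun n _ => abs_nonneg (c n))
        (Finset.mem_range.2 (Nat.lt_succ_of_le hn))
  refine ⟨2 ^ N * CH * (N.factorial * D * CW ^ N), by positivity, fun p hp R hR n hn z => ?_⟩
  by_cases hz : ‖z‖ ≤ r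
  swap
  · have : z ∉ tsupport (fun z => R * H (p, z) * (1 + (R * W (p, z)) ^ 2)⁻¹) := by
      intro h
      have h2 : tsupport (fun z => R * H (p, z) * (1 + (R * W (p, z)) ^ 2)⁻¹)
          ⊆ Metric.closedBall 0 r := by
        refine closure_minimal (fun w hw => ?_) Metric.isClosed_closedBall
        by_contra hwr
        exact hw (by simp [hr p w (by simpa using hwr)])
      exact hz (by simpa using h2 h)
    have h0 : iteratedFDeriv ℝ n (fun z => R * H (p, z) * (1 + (R * W (p, z)) ^ 2)⁻¹) z = 0 := by
      by_contra h
      exact this (support_iteratedFDeriv_subset n h)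
    rw [h0, norm_zero]
    positivity
  have hmem : (p, z) ∈ K ×ˢ Metric.closedBall (0 : V) r := ⟨hp, by simpa using hz⟩
  have hHs : ContDiff ℝ (⊤ : ℕ∞) (fun z => H (p, z)) := hH.comp (by fun_prop)
  have hWs : ContDiff ℝ (⊤ : ℕ∞) (fun z => W (p, z)) := hW.comp (by fun_prop)
  have hg : ContDiff ℝ (⊤ : ℕ∞) (fun u : ℝ => (1 + u ^ 2)⁻¹) :=
    ContDiff.inv (by fun_prop) fun u => by positivity
  have hle (m : ℕ) : (m : WithTop ℕ∞) ≤ ((⊤ : ℕ∞) : WithTop ℕ∞) := by exact_mod_cast le_top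
  have b1 (i : ℕ) (hi : i ≤ N) : ‖iteratedFDeriv ℝ i (fun z => R * H (p, z)) z‖ ≤ R * CH := by
    have := iteratedFDeriv_const_smul_apply (𝕜 := ℝ) (i := i) (a := R) (x := z)
      ((hHs.of_le (hle i)).contDiffAt)
    simp only [smul_eq_mul, Pi.smul_def] at this
    rw [this, norm_smul, Real.norm_of_nonneg (by linarith)]
    exact mul_le_mul_of_nonneg_left (hCH i hi p z hmem) (by linarith)
  have b2 (i : ℕ) (hi : i ≤ N) : ‖iteratedFDeriv ℝ i (fun z => R * W (p, z)) z‖ ≤ R * CW := by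
    have := iteratedFDeriv_const_smul_apply (𝕜 := ℝ) (i := i) (a := R) (x := z)
      ((hWs.of_le (hle i)).contDiffAt)
    simp only [smul_eq_mul, Pi.smul_def] at this
    rw [this, norm_smul, Real.norm_of_nonneg (by linarith)]
    exact mul_le_mul_of_nonneg_left (hCW i hi p z hmem) (by linarith)
  have hRW : 1 ≤ R * CW := one_le_mul_of_one_le_of_one_le hR hCW1
  have b3 (i : ℕ) (hi : i ≤ N) :
      ‖iteratedFDeriv ℝ i (fun z => (1 + (R * W (p, z)) ^ 2)⁻¹) z‖
        ≤ N.factorial * D * (R * CW) ^ N := by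
    have h := norm_iteratedFDeriv_comp_le (n := i) hg (contDiff_const.mul hWs : ContDiff ℝ _
      (fun z => R * W (p, z))) (hle i) z (C := D) (D := R * CW)
      (fun j hj => hDc j (hj.trans hi) _)
      (fun j hj1 hj => (b2 j (hj.trans hi)).trans (le_self_pow₀ hRW (by omega)))
    refine h.trans ?_
    gcongr
  have hfac : ContDiff ℝ (⊤ : ℕ∞) (fun z => (1 + (R * W (p, z)) ^ 2)⁻¹) :=
    hg.comp (contDiff_const.mul hWs)
  refine (norm_iteratedFDeriv_mul_le (contDiff_const.mul hHs) hfac z (hle n)).trans ?_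
  calc _ ≤ ∑ i ∈ Finset.range (n + 1), (n.choose i : ℝ) * (R * CH) *
            (N.factorial * D * (R * CW) ^ N) := by
        refine Finset.sum_le_sum fun i hi => ?_
        have hi' := Finset.mem_range_succ_iff.1 hi
        gcongr
        · exact b1 i (hi'.trans hn)
        · exact b3 (n - i) ((Nat.sub_le _ _).trans hn)
    _ = 2 ^ n * (R * CH) * (N.factorial * D * (R * CW) ^ N) := by
        rw [← Finset.sum_mul, ← Finset.sum_mul]
        congr 2
        exact_mod_cast Nat.sum_range_choose n
    _ ≤ 2 ^ N * (R * CH) * (N.factorial * D * (R * CW) ^ N) := by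
        gcongr
        norm_num
    _ = _ := by ring

end Parametric

instance : (volume : Measure T2).IsAddHaarMeasure :=
  Measure.prod.instIsAddHaarMeasure volume volume

instance : (volume : Measure (T2 × T2)).IsAddHaarMeasure :=
  Measure.prod.instIsAddHaarMeasure volume volume

/-- The dot product pairing on `(ℝ²)²`, as a continuous bilinear form. -/
def pairing : (T2 × T2) →L[ℝ] (T2 × T2) →L[ℝ] ℝ :=
  LinearMap.toContinuousLinearMap <|
    (LinearMap.toContinuousLinearMap : ((T2 × T2) →ₗ[ℝ] ℝ) ≃ₗ[ℝ] _).toLinearMap ∘ₗ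
      LinearMap.mk₂ ℝ (fun x y : T2 × T2 => dot2 x.1 y.1 + dot2 x.2 y.2)
        (by intros; simp [dot2]; ring) (by intros; simp [dot2]; ring)
        (by intros; simp [dot2]; ring) (by intros; simp [dot2]; ring)

lemma pairing_apply (x y : T2 × T2) : pairing x y = dot2 x.1 y.1 + dot2 x.2 y.2 := rfl

lemma ft2_eq_fourierIntegral (f : T2 × T2 → ℂ) (y : T2 × T2) :
    ft2 (fun a b => f (a, b)) y =
      VectorFourier.fourierIntegral Real.fourierChar volume ((2 * π)⁻¹ • pairing).toLinearMap₁₂ f y := by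
  unfold ft2 VectorFourier.fourierIntegral
  congr 1
  ext x
  rw [Circle.smul_def, Real.fourierChar_apply, smul_eq_mul, mul_comm]
  congr 2
  have : ((2 * π)⁻¹ • pairing).toLinearMap₁₂ x y
      = (2 * π)⁻¹ * (dot2 x.1 y.1 + dot2 x.2 y.2) := rfl
  rw [this]
  have h2 : 2 * π * -((2 * π)⁻¹ * (dot2 x.1 y.1 + dot2 x.2 y.2))
      = -(dot2 x.1 y.1 + dot2 x.2 y.2) := by
    have := Real.pi_pos
    field_simp
  rw [h2]
  push_cast
  ring

lemma exists_pairing_eq_norm (y : T2 × T2) : ∃ v : T2 × T2, ‖v‖ ≤ 1 ∧ |pairing v y| = ‖y‖ := by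
  obtain ⟨⟨a, b⟩, c, d⟩ := y
  have h : ‖((a, b), (c, d))‖ = max (max |a| |b|) (max |c| |d|) := rfl
  simp only [pairing_apply, dot2, h]
  rcases max_choice (max |a| |b|) (max |c| |d|) with h1 | h1 <;> rw [h1]
  · rcases max_choice |a| |b| with h2 | h2 <;> rw [h2]
    · exact ⟨((1, 0), (0, 0)), by simp [Prod.norm_def], by simp⟩
    · exact ⟨((0, 1), (0, 0)), by simp [Prod.norm_def], by simp⟩
  · rcases max_choice |c| |d| with h2 | h2 <;> rw [h2]
    · exact ⟨((0, 0), (1, 0)), by simp [Prod.norm_def], by simp⟩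
    · exact ⟨((0, 0), (0, 1)), by simp [Prod.norm_def], by simp⟩

lemma norm_pow_mul_norm_ft2_le {f : T2 × T2 → ℂ} (hf : ContDiff ℝ (⊤ : ℕ∞) f)
    (hc : HasCompactSupport f) (n : ℕ) (y : T2 × T2) :
    ‖y‖ ^ n * ‖ft2 (fun a b => f (a, b)) y‖ ≤
      (4 * π) ^ n * ∑ i ∈ Finset.range (n + 1), ∫ x, ‖iteratedFDeriv ℝ i f x‖ := by
  obtain ⟨v, hv, hvy⟩ := exists_pairing_eq_norm y
  have hint : ∀ (k n : ℕ), (k : ℕ∞) ≤ (⊤ : ℕ∞) → (n : ℕ∞) ≤ (⊤ : ℕ∞) →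
      Integrable (fun v => ‖v‖ ^ k * ‖iteratedFDeriv ℝ n f v‖) := by
    intro k n _ _
    refine Continuous.integrable_of_hasCompactSupport ?_ ?_
    · exact (continuous_norm.pow k).mul
        (hf.continuous_iteratedFDeriv (by exact_mod_cast le_top)).norm
    · exact (hc.iteratedFDeriv n).norm.mul_left
  have h := VectorFourier.pow_mul_norm_iteratedFDeriv_fourierIntegral_le
    ((2 * π)⁻¹ • pairing) (μ := volume) hf hint (k := 0) (n := n) le_top le_top v y
  have hL : ((2 * π)⁻¹ • pairing) v y = (2 * π)⁻¹ * pairing v y := rfl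
  rw [norm_iteratedFDeriv_zero, ← ft2_eq_fourierIntegral, hL, abs_mul, hvy, mul_pow] at h
  have hsum : ∑ p ∈ Finset.range (0 + 1) ×ˢ Finset.range (n + 1),
      ∫ v, ‖v‖ ^ p.1 * ‖iteratedFDeriv ℝ p.2 f v‖
      = ∑ i ∈ Finset.range (n + 1), ∫ x, ‖iteratedFDeriv ℝ i f x‖ := by
    rw [Finset.sum_product]
    simp
  rw [hsum] at h
  have hS : 0 ≤ ∑ i ∈ Finset.range (n + 1), ∫ x, ‖iteratedFDeriv ℝ i f x‖ :=
    Finset.sum_nonneg fun i _ => integral_nonneg fun x => norm_nonneg _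
  have hpi := Real.pi_pos
  have h3 : (2 * π) ^ n * |(2 * π)⁻¹| ^ n = 1 := by
    rw [← mul_pow, abs_of_pos (by positivity), mul_inv_cancel₀ (by positivity), one_pow]
  calc ‖y‖ ^ n * ‖ft2 (fun a b => f (a, b)) y‖
      = (2 * π) ^ n * (|(2 * π)⁻¹| ^ n * ‖y‖ ^ n * ‖ft2 (fun a b => f (a, b)) y‖) := by
        rw [mul_assoc, ← mul_assoc ((2 * π) ^ n), h3, one_mul]
    _ ≤ (2 * π) ^ n * (1 * 2 ^ n *
          ∑ i ∈ Finset.range (n + 1), ∫ x, ‖iteratedFDeriv ℝ i f x‖) := by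
        refine mul_le_mul_of_nonneg_left (h.trans ?_) (by positivity)
        simp only [pow_zero, mul_one, CharP.cast_eq_zero, mul_zero, zero_add]
        refine mul_le_mul_of_nonneg_right ?_ hS
        exact mul_le_mul_of_nonneg_right (pow_le_one₀ (norm_nonneg _) hv) (by positivity)
    _ = _ := by
        rw [one_mul, ← mul_assoc, ← mul_pow]
        congr 2
        ring

lemma exists_Soo2_le_of_iteratedFDeriv_le (r : ℝ) :
    ∃ C : ℝ, 0 ≤ C ∧ ∀ (f : T2 × T2 → ℝ) (M : ℝ), ContDiff ℝ (⊤ : ℕ∞) f →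
      (∀ z, r < ‖z‖ → f z = 0) → (∀ n ≤ 5, ∀ z, ‖iteratedFDeriv ℝ n f z‖ ≤ M) →
      Soo2 (fun a b => (f (a, b) : ℂ)) ≤ ENNReal.ofReal (C * M) := by
  set I : ℝ≥0∞ := ∫⁻ y : T2 × T2, ENNReal.ofReal ((1 + ‖y‖) ^ (-5 : ℝ)) with hI
  have hIfin : I < ⊤ := by
    refine finite_integral_one_add_norm ?_
    simp only [Module.finrank_prod, Module.finrank_self]
    norm_num
  set v : ℝ := volume.real (Metric.closedBall (0 : T2 × T2) r) with hv
  set A : ℝ := 2 ^ 5 * (v + (4 * π) ^ 5 * (6 * v)) with hA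
  have hv0 : 0 ≤ v := measureReal_nonneg
  have hA0 : 0 ≤ A := by have := Real.pi_pos; positivity
  refine ⟨A * I.toReal, by positivity, fun f M hf hfr hM => ?_⟩
  have hM0 : 0 ≤ M := (norm_nonneg _).trans (hM 0 (by norm_num) 0)
  set F : T2 × T2 → ℂ := fun z => (f z : ℂ) with hF
  have hFs : ContDiff ℝ (⊤ : ℕ∞) F := Complex.ofRealCLM.contDiff.comp hf
  have hts : tsupport F ⊆ Metric.closedBall 0 r := by
    refine closure_minimal (fun w hw => ?_) Metric.isClosed_closedBall
    by_contra hwr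
    exact hw (by simp [hF, hfr w (by simpa using hwr)])
  have hFc : HasCompactSupport F :=
    (isCompact_closedBall 0 r).of_isClosed_subset isClosed_closure hts
  have hFn (n : ℕ) (hn : n ≤ 5) (z : T2 × T2) : ‖iteratedFDeriv ℝ n F z‖ ≤ M := by
    have := Complex.ofRealLI.norm_iteratedFDeriv_comp_left (x := z) (i := n) (n := n)
      ((hf.of_le (by exact_mod_cast le_top)).contDiffAt) le_rfl
    exact this.le.trans (hM n hn z)
  have hint (n : ℕ) (hn : n ≤ 5) : ∫ x, ‖iteratedFDeriv ℝ n F x‖ ≤ v * M := by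
    have h1 : ∫ x, ‖iteratedFDeriv ℝ n F x‖ =
        ∫ x in Metric.closedBall 0 r, ‖iteratedFDeriv ℝ n F x‖ := by
      refine (setIntegral_eq_integral_of_forall_compl_eq_zero fun x hx => ?_).symm
      rw [norm_eq_zero]
      by_contra h
      exact hx (hts (support_iteratedFDeriv_subset n h))
    rw [h1]
    have h2 := norm_setIntegral_le_of_norm_le_const (μ := volume)
      (s := Metric.closedBall (0 : T2 × T2) r) (f := fun x => ‖iteratedFDeriv ℝ n F x‖) (C := M)
      measure_closedBall_lt_top (fun x _ => by simpa using hFn n hn x)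
    rw [mul_comm]
    exact (le_abs_self _).trans h2
  have hpt (y : T2 × T2) : ‖ft2 (fun a b => F (a, b)) y‖ ≤ A * M * (1 + ‖y‖) ^ (-5 : ℝ) := by
    have h0 := norm_pow_mul_norm_ft2_le hFs hFc 0 y
    have h5 := norm_pow_mul_norm_ft2_le hFs hFc 5 y
    have hs : ∑ i ∈ Finset.range (5 + 1), ∫ x, ‖iteratedFDeriv ℝ i F x‖ ≤ 6 * v * M := by
      refine (Finset.sum_le_sum fun i hi => hint i (Finset.mem_range_succ_iff.1 hi)).trans ?_
      simp [mul_assoc]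
    simp only [pow_zero, one_mul, zero_add, Finset.range_one, Finset.sum_singleton] at h0
    have h0' := h0.trans (hint 0 (by norm_num))
    have h5' : ‖y‖ ^ 5 * ‖ft2 (fun a b => F (a, b)) y‖ ≤ (4 * π) ^ 5 * (6 * v * M) :=
      h5.trans (mul_le_mul_of_nonneg_left hs (by have := Real.pi_pos; positivity))
    have hy : (0 : ℝ) < 1 + ‖y‖ := by positivity
    rw [Real.rpow_neg hy.le, ← div_eq_mul_inv, le_div_iff₀ (by positivity)]
    have h6 : (1 + ‖y‖) ^ (5 : ℝ) ≤ 2 ^ 5 * (1 + ‖y‖ ^ 5) := by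
      have e : (1 + ‖y‖) ^ (5 : ℝ) = (1 + ‖y‖) ^ 5 := by exact_mod_cast Real.rpow_natCast _ 5
      rw [e]
      have := add_pow_le (zero_le_one' ℝ) (norm_nonneg y) 5
      simp only [one_pow] at this
      refine this.trans (mul_le_mul_of_nonneg_right (by norm_num) (by positivity))
    calc _ ≤ ‖ft2 (fun a b => F (a, b)) y‖ * (2 ^ 5 * (1 + ‖y‖ ^ 5)) :=
          mul_le_mul_of_nonneg_left h6 (norm_nonneg _)
      _ = 2 ^ 5 * (‖ft2 (fun a b => F (a, b)) y‖ + ‖y‖ ^ 5 * ‖ft2 (fun a b => F (a, b)) y‖) := by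
          ring
      _ ≤ 2 ^ 5 * (v * M + (4 * π) ^ 5 * (6 * v * M)) :=
          mul_le_mul_of_nonneg_left (add_le_add h0' h5') (by positivity)
      _ = _ := by rw [hA]; ring
  calc Soo2 (fun a b => (f (a, b) : ℂ))
      ≤ ∫⁻ y : T2 × T2, ENNReal.ofReal (A * M) * ENNReal.ofReal ((1 + ‖y‖) ^ (-5 : ℝ)) := by
        refine lintegral_mono fun y => ?_
        rw [← ENNReal.ofReal_mul (by positivity)]
        have : ((‖ft2 (fun a b => (f (a, b) : ℂ)) y‖₊ : ℝ≥0) : ℝ≥0∞)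
            = ENNReal.ofReal ‖ft2 (fun a b => F (a, b)) y‖ := (ofReal_norm _).symm
        rw [this]
        exact ENNReal.ofReal_le_ofReal (hpt y)
    _ = ENNReal.ofReal (A * M) * I := by
        rw [lintegral_const_mul' _ _ ENNReal.ofReal_ne_top]
    _ = ENNReal.ofReal (A * I.toReal * M) := by
        rw [mul_right_comm A I.toReal M, ENNReal.ofReal_mul (p := A * M) (by positivity),
          ENNReal.ofReal_toReal hIfin.ne]

lemma Soo2_comp_linear (m : T2 → T2 → ℂ) (A A' : (T2 × T2) →ₗ[ℝ] (T2 × T2))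
    (hpair : ∀ x y, pairing (A x) (A' y) = pairing x y)
    (hdet : |LinearMap.det A| * |LinearMap.det A'| = 1) :
    Soo2 (fun a b => m (A (a, b)).1 (A (a, b)).2) = Soo2 m := by
  have hA : LinearMap.det A ≠ 0 := by rintro h; simp [h] at hdet
  have hA' : LinearMap.det A' ≠ 0 := by rintro h; simp [h] at hdet
  have emb {B : (T2 × T2) →ₗ[ℝ] (T2 × T2)} (hB : LinearMap.det B ≠ 0) : MeasurableEmbedding B :=
    (LinearEquiv.ofIsUnitDet (f := B) (v := Module.finBasis ℝ _) (v' := Module.finBasis ℝ _)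
      (by simpa using hB)).toContinuousLinearEquiv.toHomeomorph.measurableEmbedding
  have h1 (y : T2 × T2) : ft2 (fun a b => m (A (a, b)).1 (A (a, b)).2) y =
      |(LinearMap.det A)⁻¹| • ft2 m (A' y) := by
    have h2 := (emb hA).integral_map (μ := volume) (fun x : T2 × T2 => m x.1 x.2 *
      Complex.exp (-Complex.I * ((pairing x (A' y) : ℝ) : ℂ)))
    rw [Measure.map_linearMap_addHaar_eq_smul_addHaar _ hA, integral_smul_measure,
      ENNReal.toReal_ofReal (abs_nonneg _)] at h2
    simp only [hpair] at h2
    exact h2.symm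
  have h3 := (emb hA').lintegral_map (μ := volume) (fun y => (‖ft2 m y‖₊ : ℝ≥0∞))
  rw [Measure.map_linearMap_addHaar_eq_smul_addHaar _ hA', lintegral_smul_measure] at h3
  unfold Soo2
  calc _ = ∫⁻ y, ENNReal.ofReal |(LinearMap.det A)⁻¹| * (‖ft2 m (A' y)‖₊ : ℝ≥0∞) := by
        refine lintegral_congr fun y => ?_
        rw [h1, nnnorm_smul, ENNReal.coe_mul]
        congr 1
        exact (ofReal_norm _).symm.trans (by simp)
    _ = ENNReal.ofReal |(LinearMap.det A)⁻¹| * (ENNReal.ofReal |(LinearMap.det A')⁻¹| *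
          ∫⁻ y, (‖ft2 m y‖₊ : ℝ≥0∞)) := by
        rw [lintegral_const_mul' _ _ ENNReal.ofReal_ne_top, ← h3, smul_eq_mul]
    _ = _ := by
        rw [← mul_assoc, ← ENNReal.ofReal_mul (abs_nonneg _), abs_inv, abs_inv, ← mul_inv, hdet]
        simp

lemma abs_det_mul_abs_det_eq_one {A A' : (T2 × T2) →ₗ[ℝ] (T2 × T2)} (h : ∀ x, A (A' x) = x) :
    |LinearMap.det A| * |LinearMap.det A'| = 1 := by
  rw [← abs_mul, ← LinearMap.det_comp, show A ∘ₗ A' = LinearMap.id from LinearMap.ext h]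
  simp

lemma Soo2_swap (m : T2 → T2 → ℂ) : Soo2 (fun a b => m b a) = Soo2 m := by
  let A : (T2 × T2) →ₗ[ℝ] (T2 × T2) := (LinearMap.snd ℝ T2 T2).prod (LinearMap.fst ℝ T2 T2)
  refine Soo2_comp_linear m A A (fun x y => ?_) (abs_det_mul_abs_det_eq_one fun x => rfl)
  change dot2 x.2 y.2 + dot2 x.1 y.1 = dot2 x.1 y.1 + dot2 x.2 y.2
  ring

lemma Soo2_shear (m : T2 → T2 → ℂ) : Soo2 (fun a b => m a (-(a + b))) = Soo2 m := by
  let A : (T2 × T2) →ₗ[ℝ] (T2 × T2) := (LinearMap.fst ℝ T2 T2).prod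
    (-(LinearMap.fst ℝ T2 T2 + LinearMap.snd ℝ T2 T2))
  let A' : (T2 × T2) →ₗ[ℝ] (T2 × T2) := (LinearMap.fst ℝ T2 T2 - LinearMap.snd ℝ T2 T2).prod
    (-LinearMap.snd ℝ T2 T2)
  have hA : |LinearMap.det A| * |LinearMap.det A| = 1 :=
    abs_det_mul_abs_det_eq_one fun x => by simp [A]
  have hA' : |LinearMap.det A'| * |LinearMap.det A'| = 1 :=
    abs_det_mul_abs_det_eq_one fun x => by simp [A']
  have h1 : |LinearMap.det A| = 1 := by nlinarith [abs_nonneg (LinearMap.det A)]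
  have h2 : |LinearMap.det A'| = 1 := by nlinarith [abs_nonneg (LinearMap.det A')]
  refine Soo2_comp_linear m A A' (fun x y => ?_) (by rw [h1, h2, one_mul])
  change dot2 x.1 (y.1 - y.2) + dot2 (-(x.1 + x.2)) (-y.2) = dot2 x.1 y.1 + dot2 x.2 y.2
  simp only [dot2, Prod.fst_neg, Prod.snd_neg, Prod.fst_add, Prod.snd_add, Prod.fst_sub, Prod.snd_sub]
  ring

lemma Soo2_scale (m : T2 → T2 → ℂ) {a b : ℝ} (ha : a ≠ 0) (hb : b ≠ 0) :
    Soo2 (fun x y => m (a • x) (b • y)) = Soo2 m := by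
  let A (a b : ℝ) : (T2 × T2) →ₗ[ℝ] (T2 × T2) := (a • LinearMap.fst ℝ T2 T2).prod
    (b • LinearMap.snd ℝ T2 T2)
  refine Soo2_comp_linear m (A a b) (A a⁻¹ b⁻¹) (fun x y => ?_)
    (abs_det_mul_abs_det_eq_one fun x => by simp [A, smul_smul, ha, hb])
  change dot2 (a • x.1) (a⁻¹ • y.1) + dot2 (b • x.2) (b⁻¹ • y.2) = dot2 x.1 y.1 + dot2 x.2 y.2
  simp only [dot2, Prod.smul_fst, Prod.smul_snd, smul_eq_mul]
  field_simp

lemma dot2_self_nonneg (u : T2) : 0 ≤ dot2 u u :=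
  add_nonneg (mul_self_nonneg _) (mul_self_nonneg _)

lemma dot2_smul_self (a : ℝ) (u : T2) : dot2 (a • u) (a • u) = a ^ 2 * dot2 u u := by
  simp only [dot2, Prod.smul_fst, Prod.smul_snd, smul_eq_mul]
  ring

lemma eq_zero_of_dot2_self_le_zero {u : T2} (h : dot2 u u ≤ 0) : u = 0 := by
  simp only [dot2] at h
  ext
  · exact mul_self_eq_zero.1 (by nlinarith [mul_self_nonneg u.1, mul_self_nonneg u.2])
  · exact mul_self_eq_zero.1 (by nlinarith [mul_self_nonneg u.1, mul_self_nonneg u.2])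

lemma sq_norm_le_dot2_self (u : T2) : ‖u‖ ^ 2 ≤ dot2 u u := by
  have h : ‖u‖ = max |u.1| |u.2| := rfl
  rw [h, dot2]
  rcases max_choice |u.1| |u.2| with h1 | h1 <;> rw [h1, sq_abs] <;>
    nlinarith [mul_self_nonneg u.1, mul_self_nonneg u.2]

/-- A smooth function supported in the annulus `1/3 < |x| < 3/2`. -/
def IsAnnular (χ : T2 → ℝ) : Prop :=
  ContDiff ℝ (⊤ : ℕ∞) χ ∧ ∀ x, χ x ≠ 0 → 1 / 9 < dot2 x x ∧ dot2 x x < 9 / 4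

lemma IsCutoff.eq_zero {φ : T2 → ℝ} (hφ : IsCutoff φ) {x : T2} (h : 9 / 4 ≤ dot2 x x) :
    φ x = 0 :=
  hφ.2.2.2 x (Real.le_sqrt_of_sq_le (by norm_num; exact h))

lemma IsCutoff.eq_one {φ : T2 → ℝ} (hφ : IsCutoff φ) {x : T2} (h : dot2 x x ≤ 4 / 9) :
    φ x = 1 :=
  hφ.2.2.1 x (Real.sqrt_le_iff.2 ⟨by norm_num, by norm_num; exact h⟩)

lemma IsCutoff.isAnnular {φ : T2 → ℝ} (hφ : IsCutoff φ) :
    IsAnnular fun x => φ x - φ ((2 : ℝ) • x) := by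
  have h1 : ContDiff ℝ (⊤ : ℕ∞) φ := hφ.1
  refine ⟨by fun_prop, fun x hx => ⟨?_, ?_⟩⟩ <;> contrapose! hx
  · rw [hφ.eq_one (by linarith), hφ.eq_one (by rw [dot2_smul_self]; linarith), sub_self]
  · have := dot2_smul_self 2 x
    rw [hφ.eq_zero hx, hφ.eq_zero (by linarith), sub_self]

lemma IsAnnular.comp_neg {χ : T2 → ℝ} (h : IsAnnular χ) : IsAnnular fun x => χ (-x) := by
  have h1 := h.1
  refine ⟨by fun_prop, fun x hx => ?_⟩
  have h2 := h.2 (-x) hx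
  rwa [show dot2 (-x) (-x) = dot2 x x by simp [dot2]] at h2

/-- `√(cos² α + sin² α |u|² + φ(v))`: up to the factor `cos α` and the regularization `φ(v)`, this
is `Λ(u tan α)`, written so as to be smooth uniformly in the scale `tan α`. -/
def regLam (φ : T2 → ℝ) (α : ℝ) (u v : T2) : ℝ :=
  √(cos α ^ 2 + sin α ^ 2 * dot2 u u + φ v)

lemma regLam_radicand_pos {φ : T2 → ℝ} (hφ : IsCutoff φ) (α : ℝ) {u v : T2} (h : u = 0 → v = 0) :
    0 < cos α ^ 2 + sin α ^ 2 * dot2 u u + φ v := by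
  have h0 := (hφ.2.1 v).1
  have h1 := sin_sq_add_cos_sq α
  rcases (dot2_self_nonneg u).lt_or_eq with hu | hu
  · by_contra! hc
    have h2 : 0 ≤ sin α ^ 2 * dot2 u u := by positivity
    have h3 : sin α ^ 2 * dot2 u u = 0 := by nlinarith [sq_nonneg (cos α)]
    have h4 : cos α ^ 2 = 0 := by nlinarith [sq_nonneg (cos α)]
    rcases mul_eq_zero.1 h3 with h5 | h5 <;> linarith
  · have hv : φ v = 1 := hφ.eq_one (by
      rw [h (eq_zero_of_dot2_self_le_zero hu.ge)]; norm_num [dot2])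
    rw [hv, ← hu]
    positivity

lemma regLam_pos {φ : T2 → ℝ} (hφ : IsCutoff φ) (α : ℝ) {u v : T2} (h : u = 0 → v = 0) : 0 < regLam φ α u v :=
  Real.sqrt_pos.2 (regLam_radicand_pos hφ α h)

lemma contDiff_regLam {φ : T2 → ℝ} (hφ : IsCutoff φ) {V : Type*} [NormedAddCommGroup V]
    [NormedSpace ℝ V] {α : V → ℝ} {u v : V → T2} (hα : ContDiff ℝ (⊤ : ℕ∞) α) (hu : ContDiff ℝ (⊤ : ℕ∞) u)
    (hv : ContDiff ℝ (⊤ : ℕ∞) v) (h : ∀ p, u p = 0 → v p = 0) :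
    ContDiff ℝ (⊤ : ℕ∞) fun p => regLam φ (α p) (u p) (v p) := by
  refine ContDiff.sqrt ?_ fun p => (regLam_radicand_pos hφ (α p) (h p)).ne'
  have := hφ.1
  unfold dot2
  fun_prop

lemma sqrt_one_add_sq_mul_regLam {φ : T2 → ℝ} {S : ℝ} {u v : T2} (hv : φ v = 0) :
    √(1 + S ^ 2) * regLam φ (arctan S) u v = lam (S • u) := by
  have hS : (0 : ℝ) < 1 + S ^ 2 := by positivity
  rw [regLam, lam, ← Real.sqrt_mul hS.le, hv, cos_sq_arctan, sin_sq_arctan, dot2_smul_self]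
  congr 1
  field_simp
  ring

lemma phase_factorization (x y : T2) {τ : ℝ} (hτ : τ ^ 2 = 1) :
    (lam (x + y) + lam x + τ * lam y) * (lam (x + y) + lam x - τ * lam y) *
      ((lam (x + y) - lam x) ^ 2 - lam y ^ 2) =
    -(3 + 2 * (dot2 x x + dot2 y y + dot2 (x + y) (x + y))
      + 4 * (x.1 * y.2 - x.2 * y.1) ^ 2) := by
  have h (u : T2) : lam u ^ 2 = 1 + dot2 u u :=
    Real.sq_sqrt (by linarith [dot2_self_nonneg u])
  have e : (lam (x + y) + lam x + τ * lam y) * (lam (x + y) + lam x - τ * lam y) *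
      ((lam (x + y) - lam x) ^ 2 - lam y ^ 2) =
      (lam (x + y) ^ 2 - lam x ^ 2) ^ 2
        - 2 * lam y ^ 2 * (lam (x + y) ^ 2 + lam x ^ 2) + (lam y ^ 2) ^ 2 := by
    linear_combination (-(lam y ^ 2) * ((lam (x + y) - lam x) ^ 2 - lam y ^ 2)) * hτ
  rw [e, h, h, h]
  simp only [dot2, Prod.fst_add, Prod.snd_add]
  ring

section symbol

variable (φ : T2 → ℝ)

/-- The parameters are, in order: the angles `α`, `β` encoding the frequency scales, the ratio `ε` of
the scales, the ratio `κ` of the weights, the scale `s` of the output, the sign `τ`, and the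
coefficients of the two sign configurations. -/
abbrev Par : Type := Fin 8 → ℝ

/-- The rescaled output frequency `x + εy`. -/
def outFreq (p : Par × (T2 × T2)) : T2 := p.2.1 + p.1 2 • p.2.2

/-- The rescaled `Λ(ξ₁)`. -/
def symA (p : Par × (T2 × T2)) : ℝ := regLam φ (p.1 0) p.2.1 ((8 : ℝ) • p.2.1)

/-- The rescaled `Λ(ξ₂)`. -/
def symB (p : Par × (T2 × T2)) : ℝ := regLam φ (p.1 1) p.2.2 ((8 : ℝ) • p.2.2)

/-- The rescaled `Λ(ξ₁ + ξ₂)`. -/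
def symC (p : Par × (T2 × T2)) : ℝ :=
  regLam φ (p.1 0) (outFreq p) ((8 : ℝ) • p.1 4 • outFreq p)

/-- The rescaled `Λ(ξ₁ + ξ₂) - Λ(ξ₁)`. -/
def symD (p : Par × (T2 × T2)) : ℝ :=
  sin (p.1 1) * sin (p.1 0) * (2 * dot2 p.2.1 p.2.2 + p.1 2 * dot2 p.2.2 p.2.2)
    / (symC φ p + symA φ p)

/-- The nondegenerate part of the rescaled product of conjugate phases. -/
def symE (p : Par × (T2 × T2)) : ℝ :=
  3 * cos (p.1 0) ^ 2 + 2 * sin (p.1 0) ^ 2 * (dot2 p.2.1 p.2.1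
    + p.1 2 ^ 2 * dot2 p.2.2 p.2.2 + dot2 (outFreq p) (outFreq p)) + φ ((8 : ℝ) • p.2.1)

/-- The rescaled cross product `ξ₁ × ξ₂`, relative to the nondegenerate part. -/
def symW (p : Par × (T2 × T2)) : ℝ :=
  2 * sin (p.1 0) * sin (p.1 1) * (p.2.1.1 * p.2.2.2 - p.2.1.2 * p.2.2.1) / √(symE φ p)

/-- The rescaled product of the conjugate factors of the phase. -/
def symG (p : Par × (T2 × T2)) : ℝ :=
  p.1 6 * (p.1 3 * (symC φ p + symA φ p - p.1 5 * p.1 3 * symB φ p)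
      * (symD φ p ^ 2 - symB φ p ^ 2))
    + p.1 7 * ((symD φ p - p.1 5 * symB φ p)
      * ((symC φ p + symA φ p) ^ 2 - p.1 3 ^ 2 * symB φ p ^ 2))

/-- The localized numerator of the rescaled reciprocal phase. -/
def symH (χ₁ χ₂ χ₃ : T2 → ℝ) (p : Par × (T2 × T2)) : ℝ :=
  χ₃ (p.1 4 • outFreq p) * χ₁ p.2.1 * χ₂ p.2.2 * symG φ p / symE φ p

variable {φ}

lemma symA_pos (hφ : IsCutoff φ) (p) : 0 < symA φ p := regLam_pos hφ _ fun h => by rw [h, smul_zero]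

lemma symC_pos (hφ : IsCutoff φ) (p) : 0 < symC φ p := regLam_pos hφ _ fun h => by rw [h, smul_zero, smul_zero]

lemma symE_pos (hφ : IsCutoff φ) (p) : 0 < symE φ p := by
  have h := regLam_radicand_pos hφ (p.1 0) (u := p.2.1) (v := (8 : ℝ) • p.2.1)
    fun h => by rw [h, smul_zero]
  have h1 := mul_nonneg (sq_nonneg (sin (p.1 0))) (dot2_self_nonneg p.2.1)
  have h2 := mul_nonneg (sq_nonneg (sin (p.1 0)))
    (mul_nonneg (sq_nonneg (p.1 2)) (dot2_self_nonneg p.2.2))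
  have h3 := mul_nonneg (sq_nonneg (sin (p.1 0))) (dot2_self_nonneg (outFreq p))
  unfold symE
  nlinarith [sq_nonneg (cos (p.1 0))]

lemma contDiff_outFreq : ContDiff ℝ (⊤ : ℕ∞) outFreq := by
  unfold outFreq
  fun_prop

lemma contDiff_symA (hφ : IsCutoff φ) : ContDiff ℝ (⊤ : ℕ∞) (symA φ) :=
  contDiff_regLam hφ (by fun_prop) (by fun_prop) (by fun_prop) fun p h => by rw [h, smul_zero]

lemma contDiff_symB (hφ : IsCutoff φ) : ContDiff ℝ (⊤ : ℕ∞) (symB φ) :=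
  contDiff_regLam hφ (by fun_prop) (by fun_prop) (by fun_prop) fun p h => by rw [h, smul_zero]

lemma contDiff_symC (hφ : IsCutoff φ) : ContDiff ℝ (⊤ : ℕ∞) (symC φ) := by
  have := contDiff_outFreq
  exact contDiff_regLam hφ (by fun_prop) (by fun_prop) (by fun_prop)
    fun p h => by rw [h, smul_zero, smul_zero]

lemma contDiff_symD (hφ : IsCutoff φ) : ContDiff ℝ (⊤ : ℕ∞) (symD φ) := by
  refine ContDiff.div ?_ ((contDiff_symC hφ).add (contDiff_symA hφ))
    fun p => (add_pos (symC_pos hφ p) (symA_pos hφ p)).ne'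
  unfold dot2
  fun_prop

lemma contDiff_symE (hφ : IsCutoff φ) : ContDiff ℝ (⊤ : ℕ∞) (symE φ) := by
  have h1 := contDiff_outFreq
  have h2 := hφ.1
  unfold symE dot2
  fun_prop

lemma contDiff_symW (hφ : IsCutoff φ) : ContDiff ℝ (⊤ : ℕ∞) (symW φ) := by
  refine ContDiff.div ?_ ((contDiff_symE hφ).sqrt fun p => (symE_pos hφ p).ne')
    fun p => (Real.sqrt_pos.2 (symE_pos hφ p)).ne'
  fun_prop

lemma contDiff_symG (hφ : IsCutoff φ) : ContDiff ℝ (⊤ : ℕ∞) (symG φ) := by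
  have h1 := contDiff_symA hφ
  have h2 := contDiff_symB hφ
  have h3 := contDiff_symC hφ
  have h4 := contDiff_symD hφ
  unfold symG
  fun_prop

lemma contDiff_symH (hφ : IsCutoff φ) {χ₁ χ₂ χ₃ : T2 → ℝ} (h₁ : IsAnnular χ₁)
    (h₂ : IsAnnular χ₂) (h₃ : IsAnnular χ₃) : ContDiff ℝ (⊤ : ℕ∞) (symH φ χ₁ χ₂ χ₃) := by
  refine ContDiff.div ?_ (contDiff_symE hφ) fun p => (symE_pos hφ p).ne'
  have h1 := h₁.1
  have h2 := h₂.1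
  have h3 := h₃.1
  have h4 := contDiff_symG hφ
  have h5 := contDiff_outFreq
  fun_prop

lemma symH_eq_zero {χ₁ χ₂ χ₃ : T2 → ℝ} (h₁ : IsAnnular χ₁) (h₂ : IsAnnular χ₂)
    (θ : Par) (z : T2 × T2) (hz : 3 / 2 < ‖z‖) : symH φ χ₁ χ₂ χ₃ (θ, z) = 0 := by
  have key {χ : T2 → ℝ} (h : IsAnnular χ) {u : T2} (hu : 3 / 2 < ‖u‖) : χ u = 0 := by
    by_contra hc
    nlinarith [(h.2 u hc).2, sq_norm_le_dot2_self u]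
  rw [Prod.norm_def, lt_max_iff] at hz
  rcases hz with hz | hz <;> simp [symH, key h₁, key h₂, hz]

end symbol

lemma exists_phase_mul_eq {σ₁ σ₂ σ₃ : ℝ} (h₁ : σ₁ = 1 ∨ σ₁ = -1) (h₂ : σ₂ = 1 ∨ σ₂ = -1)
    (h₃ : σ₃ = 1 ∨ σ₃ = -1) :
    ∃ τ A B : ℝ, |τ| ≤ 1 ∧ |A| ≤ 1 ∧ |B| ≤ 1 ∧ ∀ x y : T2,
      (σ₃ * lam (x + y) + σ₁ * lam x + σ₂ * lam y) *
        (A * ((lam (x + y) + lam x - τ * lam y) * ((lam (x + y) - lam x) ^ 2 - lam y ^ 2))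
          + B * ((lam (x + y) - lam x - τ * lam y) * ((lam (x + y) + lam x) ^ 2 - lam y ^ 2)))
      = 3 + 2 * (dot2 x x + dot2 y y + dot2 (x + y) (x + y))
        + 4 * (x.1 * y.2 - x.2 * y.1) ^ 2 := by
  have key (x y : T2) := phase_factorization x y (τ := 1) (by norm_num)
  rcases h₁ with rfl | rfl <;> rcases h₃ with rfl | rfl <;> rcases h₂ with rfl | rfl
  · exact ⟨1, -1, 0, by norm_num, by norm_num, by norm_num,
      fun x y => by linear_combination -key x y⟩
  · exact ⟨-1, -1, 0, by norm_num, by norm_num, by norm_num,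
      fun x y => by linear_combination -key x y⟩
  · exact ⟨-1, 0, 1, by norm_num, by norm_num, by norm_num,
      fun x y => by linear_combination -key x y⟩
  · exact ⟨1, 0, 1, by norm_num, by norm_num, by norm_num,
      fun x y => by linear_combination -key x y⟩
  · exact ⟨1, 0, -1, by norm_num, by norm_num, by norm_num,
      fun x y => by linear_combination -key x y⟩
  · exact ⟨-1, 0, -1, by norm_num, by norm_num, by norm_num,
      fun x y => by linear_combination -key x y⟩
  · exact ⟨-1, 1, 0, by norm_num, by norm_num, by norm_num,
      fun x y => by linear_combination -key x y⟩
  · exact ⟨1, 1, 0, by norm_num, by norm_num, by norm_num,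
      fun x y => by linear_combination -key x y⟩

/-- The values of the parameters at frequency scales `S` and `T`. -/
def scalePar (S T s τ A B : ℝ) : Par :=
  ![arctan S, arctan T, T / S, √(1 + T ^ 2) / √(1 + S ^ 2), s, τ, A, B]

lemma rescaled_multiplier_eq {φ χ₁ χ₂ χ₃ : T2 → ℝ} (hφ : IsCutoff φ) (h₁ : IsAnnular χ₁)
    (h₂ : IsAnnular χ₂) (h₃ : IsAnnular χ₃) {S T s σ₁ σ₂ σ₃ τ A B : ℝ} (hS : 0 < S)
    (x y : T2)
    (h : (σ₃ * lam (S • x + T • y) + σ₁ * lam (S • x) + σ₂ * lam (T • y)) *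
        (A * ((lam (S • x + T • y) + lam (S • x) - τ * lam (T • y))
            * ((lam (S • x + T • y) - lam (S • x)) ^ 2 - lam (T • y) ^ 2))
          + B * ((lam (S • x + T • y) - lam (S • x) - τ * lam (T • y))
            * ((lam (S • x + T • y) + lam (S • x)) ^ 2 - lam (T • y) ^ 2)))
      = 3 + 2 * (dot2 (S • x) (S • x) + dot2 (T • y) (T • y)
          + dot2 (S • x + T • y) (S • x + T • y))
        + 4 * ((S • x).1 * (T • y).2 - (S • x).2 * (T • y).1) ^ 2) :
    χ₃ (s • (x + (T / S) • y))
        * (σ₃ * lam (S • x + T • y) + σ₁ * lam (S • x) + σ₂ * lam (T • y))⁻¹ * χ₁ x * χ₂ y =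
      √(1 + T ^ 2) * symH φ χ₁ χ₂ χ₃ (scalePar S T s τ A B, (x, y))
        * (1 + (√(1 + T ^ 2) * symW φ (scalePar S T s τ A B, (x, y))) ^ 2)⁻¹ := by
  set p : Par × (T2 × T2) := (scalePar S T s τ A B, (x, y))
  have hH : symH φ χ₁ χ₂ χ₃ p =
    χ₃ (s • (x + (T / S) • y)) * χ₁ x * χ₂ y * symG φ p / symE φ p := rfl
  rw [hH]
  by_cases c1 : χ₁ x = 0
  · simp [c1]
  by_cases c2 : χ₂ y = 0
  · simp [c2]
  by_cases c3 : χ₃ (s • (x + (T / S) • y)) = 0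
  · simp only [c3, zero_mul, zero_div, mul_zero]
  have far {χ : T2 → ℝ} (hχ : IsAnnular χ) {u : T2} (hu : χ u ≠ 0) : φ ((8 : ℝ) • u) = 0 :=
    hφ.eq_zero (by rw [dot2_smul_self]; linarith [(hχ.2 u hu).1])
  have hφx := far h₁ c1
  have hST : S • (x + (T / S) • y) = S • x + T • y := by
    rw [smul_add, smul_smul, mul_div_cancel₀ _ hS.ne']
  set P := √(1 + S ^ 2)
  set R := √(1 + T ^ 2)
  have hP0 : 0 < P := Real.sqrt_pos.2 (by positivity)
  have hR0 : 0 < R := Real.sqrt_pos.2 (by positivity)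
  have ha : P * symA φ p = lam (S • x) := sqrt_one_add_sq_mul_regLam hφx
  have hb : R * symB φ p = lam (T • y) := sqrt_one_add_sq_mul_regLam (far h₂ c2)
  have hc : P * symC φ p = lam (S • x + T • y) := by
    rw [← hST]
    exact sqrt_one_add_sq_mul_regLam (far h₃ c3)
  have hsS : sin (arctan S) = S / P := sin_arctan S
  have hsT : sin (arctan T) = T / R := sin_arctan T
  have hcS : cos (arctan S) = 1 / P := cos_arctan S
  have ha0 := symA_pos hφ p
  have hc0 := symC_pos hφ p
  have hE0 := symE_pos hφ p
  have hlam (u : T2) : lam u ^ 2 = 1 + dot2 u u :=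
    Real.sq_sqrt (by linarith [dot2_self_nonneg u])
  have hd : R * symD φ p = lam (S • x + T • y) - lam (S • x) := by
    have e : symD φ p = sin (arctan T) * sin (arctan S)
      * (2 * dot2 x y + T / S * dot2 y y) / (symC φ p + symA φ p) := rfl
    have e2 : lam (S • x + T • y) ^ 2 - lam (S • x) ^ 2
        = 2 * (S * T) * dot2 x y + T ^ 2 * dot2 y y := by
      rw [hlam, hlam]
      simp only [dot2, Prod.fst_add, Prod.snd_add, Prod.smul_fst, Prod.smul_snd, smul_eq_mul]
      ring
    rw [← ha, ← hc] at e2 ⊢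
    rw [e, hsS, hsT]
    have : symC φ p + symA φ p ≠ 0 := (add_pos hc0 ha0).ne'
    field_simp
    linear_combination -e2
  have hQ : P ^ 2 * (symE φ p * (1 + (R * symW φ p) ^ 2)) =
      3 + 2 * (dot2 (S • x) (S • x) + dot2 (T • y) (T • y)
          + dot2 (S • x + T • y) (S • x + T • y))
        + 4 * ((S • x).1 * (T • y).2 - (S • x).2 * (T • y).1) ^ 2 := by
    have e : symE φ p = 3 * cos (arctan S) ^ 2 + 2 * sin (arctan S) ^ 2 * (dot2 x x
      + (T / S) ^ 2 * dot2 y y + dot2 (x + (T / S) • y) (x + (T / S) • y))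
      + φ ((8 : ℝ) • x) := rfl
    have e2 : symW φ p = 2 * sin (arctan S) * sin (arctan T) * (x.1 * y.2 - x.2 * y.1)
      / √(symE φ p) := rfl
    have e3 : symE φ p * (1 + (R * symW φ p) ^ 2) = symE φ p
        + (R * (2 * sin (arctan S) * sin (arctan T) * (x.1 * y.2 - x.2 * y.1))) ^ 2 := by
      rw [e2, mul_pow, div_pow, Real.sq_sqrt hE0.le]
      field_simp
    rw [e3, e, hφx, hsS, hsT, hcS, ← hST, dot2_smul_self, dot2_smul_self, dot2_smul_self]
    simp only [Prod.smul_fst, Prod.smul_snd, smul_eq_mul]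
    field_simp
    ring
  have hG : P ^ 2 * (R * symG φ p) =
      A * ((lam (S • x + T • y) + lam (S • x) - τ * lam (T • y))
            * ((lam (S • x + T • y) - lam (S • x)) ^ 2 - lam (T • y) ^ 2))
          + B * ((lam (S • x + T • y) - lam (S • x) - τ * lam (T • y))
            * ((lam (S • x + T • y) + lam (S • x)) ^ 2 - lam (T • y) ^ 2)) := by
    have e : symG φ p = A * (R / P * (symC φ p + symA φ p - τ * (R / P) * symB φ p)
      * (symD φ p ^ 2 - symB φ p ^ 2))
      + B * ((symD φ p - τ * symB φ p)
      * ((symC φ p + symA φ p) ^ 2 - (R / P) ^ 2 * symB φ p ^ 2)) := rfl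
    rw [← hd, ← hb, ← ha, ← hc, e]
    field_simp
  rw [← hG, ← hQ] at h
  set Ψ := σ₃ * lam (S • x + T • y) + σ₁ * lam (S • x) + σ₂ * lam (T • y)
  have hq : 0 < 1 + (R * symW φ p) ^ 2 := by positivity
  have hΨ : Ψ ≠ 0 := by
    rintro h0
    rw [h0, zero_mul] at h
    have : 0 < P ^ 2 * (symE φ p * (1 + (R * symW φ p) ^ 2)) := by positivity
    linarith
  have h' : Ψ * (R * symG φ p) = symE φ p * (1 + (R * symW φ p) ^ 2) := by
    have : P ^ 2 ≠ 0 := by positivity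
    apply mul_left_cancel₀ this
    linarith
  have hinv : Ψ⁻¹ = R * symG φ p / symE φ p * (1 + (R * symW φ p) ^ 2)⁻¹ := by
    rw [inv_eq_iff_eq_inv, eq_comm, ← div_eq_mul_inv, div_div, inv_div, div_eq_iff]
    · exact h'.symm
    · rintro h0
      rw [h0, mul_zero] at h'
      exact (mul_pos hE0 hq).ne h'
  rw [hinv]
  ring

lemma exists_Soo2_reciprocal_phase_le {φ χ₁ χ₂ χ₃ : T2 → ℝ} (hφ : IsCutoff φ)
    (h₁ : IsAnnular χ₁) (h₂ : IsAnnular χ₂) (h₃ : IsAnnular χ₃) :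
    ∃ C : ℝ, 0 ≤ C ∧ ∀ σ₁ σ₂ σ₃ : ℝ, (σ₁ = 1 ∨ σ₁ = -1) → (σ₂ = 1 ∨ σ₂ = -1) →
      (σ₃ = 1 ∨ σ₃ = -1) → ∀ S T U : ℝ, 0 < T → T ≤ S → T ≤ U →
      Soo2 (fun ξ η => ((χ₃ (U⁻¹ • (ξ + η))
        * (σ₃ * lam (ξ + η) + σ₁ * lam ξ + σ₂ * lam η)⁻¹ * χ₁ (S⁻¹ • ξ) * χ₂ (T⁻¹ • η) : ℝ) : ℂ))
      ≤ ENNReal.ofReal (C * (1 + T ^ 2) ^ 3) := by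
  obtain ⟨C₁, hC₁, hsoo⟩ := exists_Soo2_le_of_iteratedFDeriv_le (3 / 2)
  have hH := contDiff_symH hφ h₁ h₂ h₃
  have hW := contDiff_symW hφ
  obtain ⟨C₂, hC₂, hbd⟩ := exists_bound_iteratedFDeriv_mul_inv_one_add_sq hH hW
    (isCompact_closedBall (0 : Par) 9) (3 / 2) (symH_eq_zero h₁ h₂) 5
  refine ⟨C₁ * C₂, by positivity, fun σ₁ σ₂ σ₃ hσ₁ hσ₂ hσ₃ S T U hT hTS hTU => ?_⟩
  have hS : 0 < S := hT.trans_le hTS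
  have hU : 0 < U := hT.trans_le hTU
  rw [← Soo2_scale _ hS.ne' hT.ne']
  simp only [inv_smul_smul₀ hS.ne', inv_smul_smul₀ hT.ne']
  have hST (x y : T2) : U⁻¹ • (S • x + T • y) = (S / U) • (x + (T / S) • y) := by
    rw [smul_add, smul_add, smul_smul, smul_smul, smul_smul]
    congr 2 <;> field_simp
  simp only [hST]
  rcases le_or_gt (S / U) 9 with hs | hs
  · obtain ⟨τ, A, B, hτ, hA, hB, hAB⟩ := exists_phase_mul_eq hσ₁ hσ₂ hσ₃
    simp only [fun x y => rescaled_multiplier_eq (s := S / U) hφ h₁ h₂ h₃ hS x y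
      (hAB (S • x) (T • y))]
    set θ := scalePar S T (S / U) τ A B with hθ
    have hθ9 : θ ∈ Metric.closedBall (0 : Par) 9 := by
      have hpi := Real.pi_lt_four
      have har (t : ℝ) : |arctan t| ≤ 9 := by
        rw [abs_le]
        constructor <;> linarith [neg_pi_div_two_lt_arctan t, arctan_lt_pi_div_two t]
      rw [mem_closedBall_zero_iff, pi_norm_le_iff_of_nonneg (by norm_num)]
      have hratio : √(1 + T ^ 2) / √(1 + S ^ 2) ≤ 1 :=
        div_le_one_of_le₀ (Real.sqrt_le_sqrt (by gcongr)) (Real.sqrt_nonneg _)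
      have hTS1 : T / S ≤ 1 := div_le_one_of_le₀ hTS hS.le
      simp only [Real.norm_eq_abs, hθ, scalePar, Fin.forall_fin_succ]
      refine ⟨har S, har T, ?_, ?_, ?_, ?_, ?_, ?_, by simp⟩
      · exact (abs_of_pos (div_pos hT hS)).le.trans (hTS1.trans (by norm_num))
      · exact (abs_of_nonneg (div_nonneg (Real.sqrt_nonneg _) (Real.sqrt_nonneg _))).le.trans
          (hratio.trans (by norm_num))
      · exact (abs_of_pos (div_pos hS hU)).le.trans hs
      · exact hτ.trans (by norm_num)
      · exact hA.trans (by norm_num)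
      · exact hB.trans (by norm_num)
    have hR : 1 ≤ √(1 + T ^ 2) := Real.one_le_sqrt.2 (by nlinarith)
    have hR6 : √(1 + T ^ 2) ^ (5 + 1) = (1 + T ^ 2) ^ 3 := by
      rw [show 5 + 1 = 2 * 3 from rfl, pow_mul, Real.sq_sqrt (by positivity)]
    have hq (z : T2 × T2) : 1 + (√(1 + T ^ 2) * symW φ (θ, z)) ^ 2 ≠ 0 := by positivity
    have hsm : ContDiff ℝ (⊤ : ℕ∞) fun z : T2 × T2 => √(1 + T ^ 2) * symH φ χ₁ χ₂ χ₃ (θ, z)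
        * (1 + (√(1 + T ^ 2) * symW φ (θ, z)) ^ 2)⁻¹ := by
      have hH' : ContDiff ℝ (⊤ : ℕ∞) fun z : T2 × T2 => symH φ χ₁ χ₂ χ₃ (θ, z) :=
        hH.comp (by fun_prop)
      have hW' : ContDiff ℝ (⊤ : ℕ∞) fun z : T2 × T2 => symW φ (θ, z) := hW.comp (by fun_prop)
      exact (contDiff_const.mul hH').mul (ContDiff.inv (by fun_prop) hq)
    have := hsoo _ (C₂ * √(1 + T ^ 2) ^ (5 + 1)) hsm
      (fun z hz => by rw [symH_eq_zero h₁ h₂ θ z hz, mul_zero, zero_mul])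
      (hbd θ hθ9 _ hR)
    rw [hR6, ← mul_assoc] at this
    exact this
  · have hz (x y : T2) (c1 : χ₁ x ≠ 0) (c2 : χ₂ y ≠ 0) :
        χ₃ ((S / U) • (x + (T / S) • y)) = 0 := by
      by_contra c3
      have b1 := (h₁.2 _ c1).1
      have b2 := (h₂.2 _ c2).2
      have b3 := (h₃.2 _ c3).2
      have e : dot2 ((S / U) • x) ((S / U) • x) ≤
          2 * dot2 ((S / U) • (x + (T / S) • y)) ((S / U) • (x + (T / S) • y))
          + 2 * dot2 ((T / U) • y) ((T / U) • y) := by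
        have e1 : (T / U) = (S / U) * (T / S) := by field_simp
        rw [e1]
        simp only [dot2, Prod.fst_add, Prod.snd_add, Prod.smul_fst, Prod.smul_snd, smul_eq_mul]
        nlinarith [sq_nonneg ((S / U) * (x.1 + 2 * (T / S) * y.1)),
          sq_nonneg ((S / U) * (x.2 + 2 * (T / S) * y.2))]
      rw [dot2_smul_self, dot2_smul_self (T / U)] at e
      have e2 : (T / U) ^ 2 ≤ 1 :=
        pow_le_one₀ (by positivity) (div_le_one_of_le₀ hTU hU.le)
      have e3 : (T / U) ^ 2 * dot2 y y ≤ 1 * (9 / 4) :=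
        mul_le_mul e2 b2.le (dot2_self_nonneg y) zero_le_one
      nlinarith
    have hzero (x y : T2) : χ₃ ((S / U) • (x + (T / S) • y))
        * (σ₃ * lam (S • x + T • y) + σ₁ * lam (S • x) + σ₂ * lam (T • y))⁻¹ * χ₁ x * χ₂ y
        = 0 := by
      by_cases c1 : χ₁ x = 0
      · rw [c1, mul_zero, zero_mul]
      by_cases c2 : χ₂ y = 0
      · rw [c2, mul_zero]
      rw [hz x y c1 c2, zero_mul, zero_mul, zero_mul]
    simp only [hzero]
    simp [Soo2, ft2]

lemma one_add_sq_two_zpow_pow_le (k : ℤ) :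
    (1 + ((2 : ℝ) ^ k) ^ 2) ^ 3 ≤ 8 * (2 : ℝ) ^ (7 * kplus k) := by
  have h1 : (1 : ℝ) ≤ 2 ^ kplus k := one_le_zpow₀ (by norm_num) (le_max_right _ _)
  have h2 : (2 : ℝ) ^ k ≤ 2 ^ kplus k := zpow_le_zpow_right₀ (by norm_num) (le_max_left _ _)
  have h3 : (2 : ℝ) ^ (7 * kplus k) = (2 ^ kplus k) ^ 7 := by
    rw [mul_comm, zpow_mul]
    norm_cast
  rw [h3]
  set t : ℝ := 2 ^ kplus k
  calc (1 + ((2 : ℝ) ^ k) ^ 2) ^ 3 ≤ (t ^ 2 + t ^ 2) ^ 3 := by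
        gcongr
        exact one_le_pow₀ h1
    _ = 8 * t ^ 6 := by ring
    _ ≤ 8 * t ^ 7 := by
        gcongr
        norm_num

lemma lam_neg (x : T2) : lam (-x) = lam x := by simp [lam, dot2]

lemma phiK_eq (φ : T2 → ℝ) (k : ℤ) (x : T2) :
    phiK φ k x = φ (((2 : ℝ) ^ k)⁻¹ • x) - φ ((2 : ℝ) • ((2 : ℝ) ^ k)⁻¹ • x) := by
  rw [phiK, smul_smul, ← zpow_neg, ← zpow_one_add₀ two_ne_zero,
    show -(k - 1) = 1 + -k by ring]

/-- Lemma 4.4 / `1/F-Soo`: `‖Φ_{μν}^{-1}‖_{S^∞_{k₁,k₂;k₃}} ≲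
2^{7 min(k₁,k₂,k₃)⁺}`. -/
theorem inverse_phase_multiplier_bound (φ : T2 → ℝ) (hφ : IsCutoff φ) :
    ∃ C : ℝ, 0 < C ∧
    ∀ μ ν : ℝ, (μ = 1 ∨ μ = -1) → (ν = 1 ∨ ν = -1) →
    ∀ k₁ k₂ k₃ : ℤ,
    Soo2 (fun ξ₁ ξ₂ =>
        ((phiK φ k₃ (ξ₁ + ξ₂) * (Phi μ ν ξ₁ ξ₂)⁻¹ * phiK φ k₁ ξ₁ * phiK φ k₂ ξ₂ : ℝ) : ℂ))
      ≤ ENNReal.ofReal (C * (2:ℝ) ^ (7 * kplus (min k₁ (min k₂ k₃)))) := by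
  set χ : T2 → ℝ := fun x => φ x - φ ((2 : ℝ) • x)
  have hχ : IsAnnular χ := hφ.isAnnular
  have hK (k : ℤ) (x : T2) : phiK φ k x = χ (((2 : ℝ) ^ k)⁻¹ • x) := phiK_eq φ k x
  obtain ⟨C₁, hC₁, hb₁⟩ := exists_Soo2_reciprocal_phase_le hφ hχ hχ hχ
  obtain ⟨C₂, hC₂, hb₂⟩ := exists_Soo2_reciprocal_phase_le hφ hχ hχ.comp_neg hχ.comp_neg
  have hpos (k : ℤ) : (0 : ℝ) < 2 ^ k := by positivity
  have hmono {j k : ℤ} (h : j ≤ k) : (2 : ℝ) ^ j ≤ 2 ^ k :=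
    zpow_le_zpow_right₀ (by norm_num) h
  have hneg {σ : ℝ} (h : σ = 1 ∨ σ = -1) : -σ = 1 ∨ -σ = -1 := by
    rcases h with rfl | rfl <;> norm_num
  have hfin {C : ℝ} (hC0 : 0 ≤ C) (hC : C ≤ C₁ + C₂) (k : ℤ) :
      ENNReal.ofReal (C * (1 + ((2 : ℝ) ^ k) ^ 2) ^ 3)
        ≤ ENNReal.ofReal ((8 * (C₁ + C₂) + 1) * (2 : ℝ) ^ (7 * kplus k)) := by
    refine ENNReal.ofReal_le_ofReal ?_
    have h1 := one_add_sq_two_zpow_pow_le k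
    have h2 := hpos (7 * kplus k)
    nlinarith [mul_le_mul hC h1 (by positivity) (by positivity)]
  refine ⟨8 * (C₁ + C₂) + 1, by positivity, fun μ ν hμ hν k₁ k₂ k₃ => ?_⟩
  simp only [hK, Phi]
  have hcases : (k₂ ≤ k₁ ∧ k₂ ≤ k₃) ∨ (k₁ ≤ k₂ ∧ k₁ ≤ k₃) ∨ (k₃ ≤ k₁ ∧ k₃ ≤ k₂) := by omega
  rcases hcases with ⟨h1, h2⟩ | ⟨h1, h2⟩ | ⟨h1, h2⟩
  · rw [show min k₁ (min k₂ k₃) = k₂ by omega]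
    refine le_trans (le_of_eq ?_) ((hb₁ (-μ) (-ν) 1 (hneg hμ) (hneg hν) (.inl rfl) _ _ _
      (hpos k₂) (hmono h1) (hmono h2)).trans (hfin hC₁ (by linarith) k₂))
    congr! 6 with ξ η
    ring
  · rw [show min k₁ (min k₂ k₃) = k₁ by omega]
    refine le_trans (le_of_eq ?_) ((hb₁ (-ν) (-μ) 1 (hneg hν) (hneg hμ) (.inl rfl) _ _ _
      (hpos k₁) (hmono h1) (hmono h2)).trans (hfin hC₁ (by linarith) k₁))
    rw [← Soo2_swap]
    congr! 3 with ξ η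
    rw [add_comm η ξ, mul_right_comm]
    congr 4
    ring
  · rw [show min k₁ (min k₂ k₃) = k₃ by omega]
    refine le_trans (le_of_eq ?_) ((hb₂ (-μ) 1 (-ν) (hneg hμ) (.inl rfl) (hneg hν) _ _ _
      (hpos k₃) (hmono h1) (hmono h2)).trans (hfin hC₂ (by linarith) k₃))
    rw [← Soo2_shear]
    congr! 3 with ξ η
    rw [show ξ + -(ξ + η) = -η by abel, smul_neg, smul_neg, lam_neg, lam_neg,
      show -ν * lam (ξ + η) + -μ * lam ξ + 1 * lam η
        = lam η - μ * lam ξ - ν * lam (ξ + η) by ring]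
    exact congrArg Complex.ofReal (by ring)

end EP
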